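/- (Generalized Lebesgue differentiation theorem) Let Ω ⊂ ℝ^{N+1} be open and f ∈ L¹(Ω). Then for almost every (x,t) ∈ Ω, lim_{r→0⁺} (1/|Q_r(x,t)|) ∫_{Q_r(x,t)} |f(y,s) − f(x,t)| dy ds = 0. -/

import Mathlib

open MeasureTheory

noncomputable section

abbrev KSpace (N : ℕ) : Type := (Fin N → ℝ) × ℝ

/-- `E(s) = exp(-s B)`, defined by the exponential power series. -/
noncomputable def Emat {N : ℕ} (B : Matrix (Fin N) (Fin N) ℝ) (s : ℝ) :
    Matrix (Fin N) (Fin N) ℝ :=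
  ∑' n : ℕ, ((n.factorial : ℝ)⁻¹) • ((-s) • B) ^ n

/-- The group law `(x,t)∘(ξ,τ) = (ξ + E(τ)x, t+τ)`; `grpMul B z w = z ∘ w`. -/
def grpMul {N : ℕ} (B : Matrix (Fin N) (Fin N) ℝ) (z w : KSpace N) : KSpace N :=
  (w.1 + (Emat B w.2).mulVec z.1, z.2 + w.2)

/-- The candidate inverse `(x,t)⁻¹ = (-E(-t)x, -t)`. -/
def grpInv {N : ℕ} (B : Matrix (Fin N) (Fin N) ℝ) (z : KSpace N) : KSpace N :=
  (-(Emat B (-z.2)).mulVec z.1, -z.2)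

/-- Partial sums of block sizes: `offsetSum m j = m 0 + ⋯ + m (j-1)`. -/
def offsetSum (m : ℕ → ℕ) (j : ℕ) : ℕ := ∑ l ∈ Finset.range j, m l

/-- Index of the block containing coordinate `i`. -/
def blkIdx (κ : ℕ) (m : ℕ → ℕ) (i : ℕ) : ℕ :=
  Nat.findGreatest (fun j => offsetSum m j ≤ i) κ

/-- The dilation exponent of coordinate `i`: `α_i = 2j+1` when `i` lies in block `j`. -/
def alphaExp (κ : ℕ) (m : ℕ → ℕ) (i : ℕ) : ℕ := 2 * blkIdx κ m i + 1

/-- The spatial homogeneous dimension `Q = m₀ + 3 m₁ + ⋯ + (2κ+1) m_κ`. -/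
def homDim (κ : ℕ) (m : ℕ → ℕ) : ℕ := ∑ j ∈ Finset.range (κ + 1), (2 * j + 1) * m j

/-- `B` is in canonical form with blocks `m 0 ≥ m 1 ≥ … ≥ m κ ≥ 1` summing to `N`:
its only nonzero entries lie in blocks `B_j` (of size `m j × m (j-1)`) just below
the diagonal blocks, and each such block has rank `m j`. -/
def IsCanonical (N κ : ℕ) (m : ℕ → ℕ) (B : Matrix (Fin N) (Fin N) ℝ) : Prop :=
  (∀ j, j ≤ κ → 1 ≤ m j) ∧
  (∀ j, j < κ → m (j + 1) ≤ m j) ∧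
  (∑ j ∈ Finset.range (κ + 1), m j = N) ∧
  (∀ i i' : Fin N, B i i' ≠ 0 → blkIdx κ m (i : ℕ) = blkIdx κ m (i' : ℕ) + 1) ∧
  (∀ j, 1 ≤ j → j ≤ κ →
    (Matrix.of fun a b : Fin N =>
        if blkIdx κ m (a : ℕ) = j ∧ blkIdx κ m (b : ℕ) = j - 1 then B a b else 0).rank = m j)

/-- The dilation `δ_r` acting on `ℝ^{N+1}`. -/
def dil {N : ℕ} (κ : ℕ) (m : ℕ → ℕ) (r : ℝ) (z : KSpace N) : KSpace N :=
  (fun i => r ^ alphaExp κ m (i : ℕ) * z.1 i, r ^ 2 * z.2)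

/-- The unit cylinder `Q₁ = B₁ × ⋯ × B₁ × (-1,0)`, one Euclidean unit ball per block. -/
def unitCyl (N κ : ℕ) (m : ℕ → ℕ) : Set (KSpace N) :=
  {z | (∀ j, j ≤ κ → (∑ i : Fin N, if blkIdx κ m (i : ℕ) = j then z.1 i ^ 2 else 0) < 1) ∧
    z.2 ∈ Set.Ioo (-1 : ℝ) 0}

/-- The cylinder `Q_r(z₀) = z₀ ∘ δ_r(Q₁)`. -/
def cyl {N : ℕ} (B : Matrix (Fin N) (Fin N) ℝ) (κ : ℕ) (m : ℕ → ℕ) (r : ℝ) (z₀ : KSpace N) :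
    Set (KSpace N) :=
  (fun w => grpMul B z₀ (dil κ m r w)) '' unitCyl N κ m

/-- The delayed cylinder `Q̄_r^m(z₀) = ((0,…,0,m r²) ∘ Q_r(z₀)) ∩ (ℝ^N × (t₀,∞))`. -/
def delayedCyl {N : ℕ} (B : Matrix (Fin N) (Fin N) ℝ) (κ : ℕ) (m : ℕ → ℕ) (mm : ℕ) (r : ℝ)
    (z₀ : KSpace N) : Set (KSpace N) :=
  ((fun w => grpMul B ((0 : Fin N → ℝ), (mm : ℝ) * r ^ 2) w) '' cyl B κ m r z₀) ∩
    {z : KSpace N | z₀.2 < z.2}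

/-- The stacked cylinder `kQ_r(z₀) = (0,…,0,(k²-1)r²/2) ∘ Q_{kr}(z₀)`. -/
def stackedCyl {N : ℕ} (B : Matrix (Fin N) (Fin N) ℝ) (κ : ℕ) (m : ℕ → ℕ) (k : ℕ) (r : ℝ)
    (z₀ : KSpace N) : Set (KSpace N) :=
  (fun w => grpMul B ((0 : Fin N → ℝ), (((k : ℝ) ^ 2 - 1) / 2) * r ^ 2) w) ''
    cyl B κ m ((k : ℝ) * r) z₀

/-- The `i`-th spatial unit direction in `ℝ^{N+1}`. -/
def eSpat (N : ℕ) (i : Fin N) : KSpace N := (Pi.single i 1, 0)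

/-- The time direction in `ℝ^{N+1}`. -/
def eTime (N : ℕ) : KSpace N := (0, 1)

/-- The principal Kolmogorov operator
`K u = Σ_{i<m₀} ∂²_{x_i} u + ⟨Bx, Du⟩ - ∂_t u`. -/
def Kop {N : ℕ} (m₀ : ℕ) (B : Matrix (Fin N) (Fin N) ℝ) (u : KSpace N → ℝ) (z : KSpace N) : ℝ :=
  (∑ i : Fin N, if (i : ℕ) < m₀ then
      fderiv ℝ (fun w => fderiv ℝ u w (eSpat N i)) z (eSpat N i) else 0)
    + (∑ i : Fin N, B.mulVec z.1 i * fderiv ℝ u z (eSpat N i))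
    - fderiv ℝ u z (eTime N)

/-- The drift operator `Y u = ⟨Bx, Du⟩ - ∂_t u`. -/
def Yop {N : ℕ} (B : Matrix (Fin N) (Fin N) ℝ) (u : KSpace N → ℝ) (z : KSpace N) : ℝ :=
  (∑ i : Fin N, B.mulVec z.1 i * fderiv ℝ u z (eSpat N i)) - fderiv ℝ u z (eTime N)

/-- The matrix `A₀` with identity top-left `m₀ × m₀` block and zeros elsewhere. -/
def A0mat (N m₀ : ℕ) : Matrix (Fin N) (Fin N) ℝ :=
  Matrix.of fun i j : Fin N => if (i : ℕ) < m₀ ∧ i = j then 1 else 0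

/-- `C(t) = ∫₀ᵗ E(s) A₀ E(s)ᵀ ds`, entrywise. -/
def Cmat {N : ℕ} (B : Matrix (Fin N) (Fin N) ℝ) (m₀ : ℕ) (t : ℝ) : Matrix (Fin N) (Fin N) ℝ :=
  Matrix.of fun i j : Fin N => ∫ s in (0:ℝ)..t, (Emat B s * A0mat N m₀ * (Emat B s).transpose) i j

/-- The fundamental solution `Γ((x,t),(0,0))`. -/
def fundSol {N : ℕ} (B : Matrix (Fin N) (Fin N) ℝ) (m₀ : ℕ) (z : KSpace N) : ℝ :=
  if 0 < z.2 then
    (4 * Real.pi) ^ (-(N : ℝ) / 2) * (Cmat B m₀ z.2).det ^ (-(1 : ℝ) / 2) *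
      Real.exp (-(1/4) * (∑ i : Fin N, ((Cmat B m₀ z.2)⁻¹).mulVec z.1 i * z.1 i)
        - z.2 * B.trace)
  else 0

/-- The two-point fundamental solution `Γ(z,ζ) = Γ(ζ⁻¹ ∘ z, 0)`. -/
def fundSol2 {N : ℕ} (B : Matrix (Fin N) (Fin N) ℝ) (m₀ : ℕ) (z ζ : KSpace N) : ℝ :=
  fundSol B m₀ (grpMul B (grpInv B ζ) z)

/-- The homogeneous norm: `‖z‖` is the unique `r > 0` with
`Σ_i x_i²/r^{2α_i} + t²/r⁴ = 1` (and `‖0‖ = 0`); realized as an infimum. -/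
def homNorm {N : ℕ} (κ : ℕ) (m : ℕ → ℕ) (z : KSpace N) : ℝ :=
  sInf {r : ℝ | 0 < r ∧
    (∑ i : Fin N, z.1 i ^ 2 / r ^ (2 * alphaExp κ m (i : ℕ))) + z.2 ^ 2 / r ^ 4 = 1}

end

noncomputable section

open Filter Topology Set
open scoped ENNReal

section MatrixExponential

variable {N : ℕ} (B : Matrix (Fin N) (Fin N) ℝ)

lemma Emat_eq_exp (s : ℝ) : Emat B s = NormedSpace.exp ((-s) • B) := by
  rw [NormedSpace.exp_eq_tsum ℝ]
  rfl

lemma Emat_zero : Emat B 0 = 1 := by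
  simp [Emat_eq_exp]

lemma Emat_add (s t : ℝ) : Emat B (s + t) = Emat B s * Emat B t := by
  simp only [Emat_eq_exp]
  rw [neg_add, add_smul]
  exact Matrix.exp_add_of_commute _ _ (((Commute.refl B).smul_left _).smul_right _)

open scoped Matrix.Norms.Operator in
lemma continuous_Emat : Continuous (Emat B) := by
  have h : Emat B = fun s => NormedSpace.exp ((-s) • B) := funext (Emat_eq_exp B)
  rw [h]
  exact NormedSpace.exp_continuous.comp (by fun_prop)

/-- The spatial part of the dilation, as a diagonal matrix. -/
def dilMatrix (N κ : ℕ) (m : ℕ → ℕ) (r : ℝ) : Matrix (Fin N) (Fin N) ℝ :=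
  Matrix.diagonal fun i => r ^ alphaExp κ m (i : ℕ)

variable {B} {κ : ℕ} {m : ℕ → ℕ}

/-- The dilations intertwine the one-parameter groups `E(τ)` and `E(r²τ)`. -/
lemma Emat_mul_dilMatrix
    (hB : ∀ i i' : Fin N, B i i' ≠ 0 → blkIdx κ m (i : ℕ) = blkIdx κ m (i' : ℕ) + 1)
    {r : ℝ} (hr : r ≠ 0) (s : ℝ) :
    Emat B (r ^ 2 * s) * dilMatrix N κ m r = dilMatrix N κ m r * Emat B s := by
  have hU : IsUnit (dilMatrix N κ m r) := by
    rw [dilMatrix, Matrix.isUnit_diagonal, Pi.isUnit_iff]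
    exact fun i => (pow_ne_zero _ hr).isUnit
  have hdet := (Matrix.isUnit_iff_isUnit_det _).1 hU
  have hcomm : dilMatrix N κ m r * ((-s) • B) = ((-(r ^ 2 * s)) • B) * dilMatrix N κ m r := by
    ext i j
    simp only [dilMatrix, Matrix.diagonal_mul, Matrix.mul_diagonal, Matrix.smul_apply, smul_eq_mul]
    by_cases h : B i j = 0
    · simp [h]
    · rw [alphaExp, alphaExp, hB i j h]
      ring
  have hconj : (-(r ^ 2 * s)) • B
      = dilMatrix N κ m r * ((-s) • B) * (dilMatrix N κ m r)⁻¹ := by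
    rw [hcomm, Matrix.mul_nonsing_inv_cancel_right _ _ hdet]
  rw [Emat_eq_exp, Emat_eq_exp, hconj, Matrix.exp_conj _ _ hU,
    Matrix.nonsing_inv_mul_cancel_right _ _ hdet]

end MatrixExponential

section Cylinders

variable {N : ℕ} (B : Matrix (Fin N) (Fin N) ℝ) (κ : ℕ) (m : ℕ → ℕ)

/-- Left translation by `z`, as a homeomorphism. -/
def leftTranslation (z : KSpace N) : KSpace N ≃ₜ KSpace N where
  toFun := grpMul B z
  invFun w := (w.1 - (Emat B (w.2 - z.2)).mulVec z.1, w.2 - z.2)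
  left_inv w := by simp [grpMul]
  right_inv w := by simp [grpMul]
  continuous_toFun := by
    have := continuous_Emat B
    unfold grpMul
    fun_prop
  continuous_invFun := by
    have := continuous_Emat B
    fun_prop

/-- The dilation of ratio `r`, as a linear map. -/
def dilLinear (r : ℝ) : KSpace N →ₗ[ℝ] KSpace N where
  toFun := dil κ m r
  map_add' x y := by
    ext <;> simp [dil] <;> ring
  map_smul' c x := by
    ext <;> simp [dil] <;> ring

/-- The dilation of nonzero ratio `r`, as a homeomorphism. -/
def dilHomeomorph {r : ℝ} (hr : r ≠ 0) : KSpace N ≃ₜ KSpace N where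
  toFun := dil κ m r
  invFun := dil κ m r⁻¹
  left_inv w := by
    ext <;> simp [dil, hr]
  right_inv w := by
    ext <;> simp [dil, hr]
  continuous_toFun := by
    unfold dil
    fun_prop
  continuous_invFun := by
    unfold dil
    fun_prop

lemma measurePreserving_grpMul (z : KSpace N) :
    MeasurePreserving (grpMul B z) volume volume := by
  have hE := continuous_Emat B
  have h : MeasurePreserving
      (fun p : ℝ × (Fin N → ℝ) => (z.2 + p.1, p.2 + (Emat B p.1).mulVec z.1))
      (volume.prod volume) (volume.prod volume) := by
    refine (measurePreserving_add_left volume z.2).skew_product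
      (g := fun s x => x + (Emat B s).mulVec z.1) ?_ ?_
    · apply Continuous.measurable
      unfold Function.uncurry
      fun_prop
    · exact ae_of_all _ fun s => map_add_right_eq_self _ _
  exact (Measure.measurePreserving_swap.comp h).comp Measure.measurePreserving_swap

lemma volume_image_grpMul_dil (z : KSpace N) (r : ℝ) (S : Set (KSpace N)) :
    volume ((fun w => grpMul B z (dil κ m r w)) '' S)
      = ENNReal.ofReal |LinearMap.det (dilLinear (N := N) κ m r)| * volume S := by
  have h1 : (fun w => grpMul B z (dil κ m r w)) '' S
      = (leftTranslation B z).toMeasurableEquiv '' (dilLinear κ m r '' S) := by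
    rw [← image_comp]
    rfl
  have h2 : MeasurePreserving (leftTranslation B z).toMeasurableEquiv volume volume :=
    measurePreserving_grpMul B z
  have : (volume : Measure (KSpace N)).IsAddHaarMeasure :=
    Measure.prod.instIsAddHaarMeasure _ _
  rw [h1, MeasurableEquiv.image_eq_preimage_symm, h2.symm.measure_preimage_equiv,
    Measure.addHaar_image_linearMap]

lemma isOpen_unitCyl : IsOpen (unitCyl N κ m) := by
  have h : unitCyl N κ m = (⋂ j ∈ Finset.range (κ + 1), {z : KSpace N |
      (∑ i : Fin N, if blkIdx κ m (i : ℕ) = j then z.1 i ^ 2 else 0) < 1}) ∩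
        Prod.snd ⁻¹' Ioo (-1 : ℝ) 0 := by
    ext z
    simp [unitCyl]
  rw [h]
  refine IsOpen.inter (isOpen_biInter_finset fun j _ => isOpen_lt ?_ continuous_const)
    (isOpen_Ioo.preimage continuous_snd)
  refine continuous_finsetSum _ fun i _ => ?_
  split_ifs <;> fun_prop

lemma unitCyl_nonempty : (unitCyl N κ m).Nonempty :=
  ⟨(0, -1 / 2), by simp, by norm_num⟩

lemma unitCyl_subset_Icc : unitCyl N κ m ⊆ Icc (fun _ => -1, -1) (fun _ => 1, 0) := by
  rintro z ⟨hz, ht⟩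
  have hx : ∀ i, |z.1 i| ≤ 1 := by
    intro i
    have h := hz (blkIdx κ m i) (Nat.findGreatest_le κ)
    have h' := Finset.single_le_sum (s := Finset.univ)
      (f := fun l : Fin N => if blkIdx κ m (l : ℕ) = blkIdx κ m i then z.1 l ^ 2 else 0)
      (fun l _ => by split_ifs <;> positivity) (Finset.mem_univ i)
    simp only [if_true] at h'
    exact (sq_le_one_iff_abs_le_one _).1 (h'.trans h.le)
  exact ⟨⟨fun i => (abs_le.1 (hx i)).1, ht.1.le⟩, ⟨fun i => (abs_le.1 (hx i)).2, ht.2.le⟩⟩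

lemma isOpen_cyl {r : ℝ} (hr : r ≠ 0) (z : KSpace N) : IsOpen (cyl B κ m r z) :=
  ((dilHomeomorph κ m hr).trans (leftTranslation B z)).isOpenMap _ (isOpen_unitCyl κ m)

lemma cyl_nonempty (r : ℝ) (z : KSpace N) : (cyl B κ m r z).Nonempty :=
  (unitCyl_nonempty κ m).image _

lemma volume_cyl_ne_zero {r : ℝ} (hr : r ≠ 0) (z : KSpace N) : volume (cyl B κ m r z) ≠ 0 := by
  have : (volume : Measure (KSpace N)).IsAddHaarMeasure :=
    Measure.prod.instIsAddHaarMeasure _ _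
  exact ((isOpen_cyl B κ m hr z).measure_pos volume (cyl_nonempty B κ m r z)).ne'

lemma volume_unitCyl_ne_top : volume (unitCyl N κ m) ≠ ⊤ :=
  measure_ne_top_of_subset (unitCyl_subset_Icc κ m) isCompact_Icc.measure_ne_top

lemma volume_cyl_ne_top (r : ℝ) (z : KSpace N) : volume (cyl B κ m r z) ≠ ⊤ := by
  rw [cyl, volume_image_grpMul_dil]
  exact ENNReal.mul_ne_top ENNReal.ofReal_ne_top (volume_unitCyl_ne_top κ m)

/-- Cylinders shrink to their vertex. -/
lemma eventually_cyl_subset {z : KSpace N} {U : Set (KSpace N)} (hU : U ∈ 𝓝 z) :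
    ∀ᶠ r in 𝓝 (0 : ℝ), cyl B κ m r z ⊆ U := by
  have hE := continuous_Emat B
  have hc : Continuous fun p : ℝ × KSpace N => grpMul B z (dil κ m p.1 p.2) := by
    unfold grpMul dil
    fun_prop
  have h0 : ∀ w : KSpace N, grpMul B z (dil κ m 0 w) = z := by
    intro w
    ext <;> simp [grpMul, dil, Emat_zero, alphaExp]
  have hK : IsCompact (Icc ((fun _ => -1, -1) : KSpace N) (fun _ => 1, 0)) := isCompact_Icc
  have h := hK.eventually_forall_of_forall_eventually (x₀ := (0 : ℝ))
    (P := fun r w => grpMul B z (dil κ m r w) ∈ U) fun w _ => by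
      refine hc.continuousAt.eventually_mem ?_
      simpa only [h0] using hU
  filter_upwards [h] with r hr
  rintro _ ⟨w, hw, rfl⟩
  exact hr w (unitCyl_subset_Icc κ m hw)

variable {B κ m}

/-- A cylinder of radius `r ≤ 2 s` meeting a cylinder of radius `s` has its vertex in an
enlargement of the latter, with a fixed bounded profile. -/
lemma exists_enlargement
    (hB : ∀ i i' : Fin N, B i i' ≠ 0 → blkIdx κ m (i : ℕ) = blkIdx κ m (i' : ℕ) + 1) :
    ∃ K : Set (KSpace N), volume K ≠ ⊤ ∧ ∀ (z w : KSpace N) (r s : ℝ), 0 < r → 0 < s → r ≤ 2 * s →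
      (cyl B κ m r z ∩ cyl B κ m s w).Nonempty →
        z ∈ (fun v => grpMul B w (dil κ m s v)) '' K := by
  have hE := continuous_Emat B
  let I : Set (KSpace N) := Icc (fun _ => -1, -1) (fun _ => 1, 0)
  let Φ : ℝ × KSpace N × KSpace N → KSpace N := fun p =>
    ((Emat B (-(p.1 ^ 2 * p.2.1.2))).mulVec (p.2.2.1 - (dil κ m p.1 p.2.1).1),
      p.2.2.2 - p.1 ^ 2 * p.2.1.2)
  have hΦ : Continuous Φ := by
    simp only [Φ, dil]
    fun_prop
  have hI : IsCompact I := isCompact_Icc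
  have hK : IsCompact (Φ '' (Icc 0 2 ×ˢ I ×ˢ I)) :=
    (isCompact_Icc.prod (hI.prod hI)).image hΦ
  refine ⟨_, hK.measure_ne_top, ?_⟩
  rintro z w r s hr hs hrs ⟨_, ⟨p, hp, rfl⟩, q, hq, hpq⟩
  refine ⟨Φ (r / s, p, q), mem_image_of_mem _
    ⟨⟨by positivity, (div_le_iff₀ hs).2 hrs⟩, unitCyl_subset_Icc κ m hp,
      unitCyl_subset_Icc κ m hq⟩, ?_⟩
  have h2 : w.2 + s ^ 2 * q.2 = z.2 + r ^ 2 * p.2 := congrArg Prod.snd hpq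
  have h1 : (dil κ m s q).1 + (Emat B (s ^ 2 * q.2)).mulVec w.1
      = (dil κ m r p).1 + (Emat B (r ^ 2 * p.2)).mulVec z.1 := congrArg Prod.fst hpq
  have hdil : ∀ (ρ : ℝ) (v : KSpace N), (dil κ m ρ v).1 = (dilMatrix N κ m ρ).mulVec v.1 := by
    intro ρ v
    ext i
    simp [dil, dilMatrix, Matrix.mulVec_diagonal]
  have hrs' : r = s * (r / s) := by field_simp
  have hdd : (dilMatrix N κ m s).mulVec (dil κ m (r / s) p).1 = (dil κ m r p).1 := by
    ext i
    simp only [dil, dilMatrix, Matrix.mulVec_diagonal]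
    rw [← mul_assoc, ← mul_pow, ← hrs']
  have hsc : s ^ 2 * ((r / s) ^ 2 * p.2) = r ^ 2 * p.2 := by field_simp
  ext i
  · refine congrFun (?_ : _ = z.1) i
    simp only [grpMul]
    rw [hdil]
    simp only [Φ]
    rw [Matrix.mulVec_mulVec, ← Emat_mul_dilMatrix hB hs.ne', ← Matrix.mulVec_mulVec,
      Matrix.mulVec_sub, hdd, ← hdil]
    have e1 : s ^ 2 * -((r / s) ^ 2 * p.2) = -(r ^ 2 * p.2) := by rw [mul_neg, hsc]
    have e2 : (dil κ m s (Φ (r / s, p, q))).2 = -(r ^ 2 * p.2) + s ^ 2 * q.2 := by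
      simp only [dil, Φ]
      rw [mul_sub, hsc]
      ring
    simp only [Φ] at e2
    rw [e1, e2, Emat_add, ← Matrix.mulVec_mulVec, ← Matrix.mulVec_add]
    have e3 : (dil κ m s q).1 - (dil κ m r p).1 + (Emat B (s ^ 2 * q.2)).mulVec w.1
        = (Emat B (r ^ 2 * p.2)).mulVec z.1 := by
      rw [sub_add_eq_add_sub, h1, add_sub_cancel_left]
    rw [e3, Matrix.mulVec_mulVec, ← Emat_add, neg_add_cancel, Emat_zero, Matrix.one_mulVec]
  · simp only [grpMul, dil, Φ]
    rw [mul_sub, hsc]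
    linarith


variable (B κ m) in
/-- The set where the maximal function over cylinders of radius at most one exceeds `c`. -/
def maximalSuperlevel (h : KSpace N → ℝ≥0∞) (c : ℝ≥0∞) : Set (KSpace N) :=
  {z | ∃ r ∈ Ioc (0 : ℝ) 1, c * volume (cyl B κ m r z) < ∫⁻ w in cyl B κ m r z, h w}

/-- Weak type `(1,1)` estimate for the maximal function over cylinders. -/
lemma exists_weak_type_bound
    (hB : ∀ i i' : Fin N, B i i' ≠ 0 → blkIdx κ m (i : ℕ) = blkIdx κ m (i' : ℕ) + 1) :
    ∃ C : ℝ≥0∞, C ≠ ⊤ ∧ ∀ (h : KSpace N → ℝ≥0∞) (c : ℝ≥0∞),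
      c * volume (maximalSuperlevel B κ m h c) ≤ C * ∫⁻ w, h w := by
  obtain ⟨K, hKtop, hK⟩ := exists_enlargement hB
  have hQ0 : volume (unitCyl N κ m) ≠ 0 := by
    have : (volume : Measure (KSpace N)).IsAddHaarMeasure :=
      Measure.prod.instIsAddHaarMeasure _ _
    exact ((isOpen_unitCyl κ m).measure_pos volume (unitCyl_nonempty κ m)).ne'
  refine ⟨volume K / volume (unitCyl N κ m), ENNReal.div_ne_top hKtop hQ0, fun h c => ?_⟩
  set C := volume K / volume (unitCyl N κ m) with hC
  have hvol : ∀ (w : KSpace N) (s : ℝ),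
      volume ((fun v => grpMul B w (dil κ m s v)) '' K) = C * volume (cyl B κ m s w) := by
    intro w s
    rw [cyl, volume_image_grpMul_dil, volume_image_grpMul_dil, mul_left_comm, hC,
      ENNReal.div_mul_cancel hQ0 (volume_unitCyl_ne_top κ m)]
  have hex : ∀ z ∈ maximalSuperlevel B κ m h c, ∃ r ∈ Ioc (0 : ℝ) 1,
    c * volume (cyl B κ m r z) < ∫⁻ w in cyl B κ m r z, h w := fun z hz => hz
  choose! ρ hρ hlt using hex
  obtain ⟨u, hut, hdisj, hcov⟩ := Vitali.exists_disjoint_subfamily_covering_enlargement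
    (fun z => cyl B κ m (ρ z) z) (maximalSuperlevel B κ m h c) ρ 2 one_lt_two
    (fun z hz => (hρ z hz).1.le) 1 (fun z hz => (hρ z hz).2) (fun z _ => cyl_nonempty B κ m _ z)
  have hopen : ∀ z ∈ u, IsOpen (cyl B κ m (ρ z) z) :=
    fun z hz => isOpen_cyl B κ m (hρ z (hut hz)).1.ne' z
  have hu : u.Countable :=
    hdisj.countable_of_isOpen hopen fun z _ => cyl_nonempty B κ m _ z
  have hsub : maximalSuperlevel B κ m h c
      ⊆ ⋃ w ∈ u, (fun v => grpMul B w (dil κ m (ρ w) v)) '' K := by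
    intro z hz
    obtain ⟨w, hw, hne, hle⟩ := hcov z hz
    exact mem_biUnion hw (hK z w _ _ (hρ z hz).1 (hρ w (hut hw)).1 hle hne)
  calc c * volume (maximalSuperlevel B κ m h c)
      ≤ c * ∑' w : u, volume ((fun v => grpMul B w (dil κ m (ρ w) v)) '' K) := by
        gcongr
        exact (measure_mono hsub).trans (measure_biUnion_le _ hu _)
    _ = C * ∑' w : u, c * volume (cyl B κ m (ρ w) w) := by
        simp_rw [hvol, ENNReal.tsum_mul_left]
        rw [mul_left_comm]
    _ ≤ C * ∑' w : u, ∫⁻ v in cyl B κ m (ρ w) w, h v := by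
        gcongr with w
        exact (hlt w (hut w.2)).le
    _ = C * ∫⁻ v in ⋃ w ∈ u, cyl B κ m (ρ w) w, h v := by
        rw [lintegral_biUnion hu (fun w hw => (hopen w hw).measurableSet) hdisj]
    _ ≤ C * ∫⁻ w, h w := by
        gcongr
        exact Measure.restrict_le_self

/-- At almost every vertex, the mean oscillation over small cylinders is at most `3 ε`. -/
lemma ae_eventually_lintegral_cyl_le
    (hB : ∀ i i' : Fin N, B i i' ≠ 0 → blkIdx κ m (i : ℕ) = blkIdx κ m (i' : ℕ) + 1)
    {F : KSpace N → ℝ} (hF : Integrable F) {ε : ℝ≥0∞} (hε : ε ≠ 0) :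
    ∀ᵐ z, ∀ᶠ r in 𝓝[>] (0 : ℝ),
      ∫⁻ w in cyl B κ m r z, ‖F w - F z‖ₑ ≤ volume (cyl B κ m r z) * (3 * ε) := by
  obtain ⟨C, hC, hweak⟩ := exists_weak_type_bound hB
  rw [ae_iff]
  set bad := {z : KSpace N | ¬ ∀ᶠ r in 𝓝[>] (0 : ℝ),
    ∫⁻ w in cyl B κ m r z, ‖F w - F z‖ₑ ≤ volume (cyl B κ m r z) * (3 * ε)}
  have key : ∀ η : ℝ≥0∞, η ≠ 0 → ε * volume bad ≤ (C + 1) * η := by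
    intro η hη
    obtain ⟨g, -, hFg, hg, hgi⟩ := hF.exists_hasCompactSupport_lintegral_sub_le hη
    have hsub : bad ⊆ maximalSuperlevel B κ m (fun w => ‖F w - g w‖ₑ) ε
        ∪ {z | ε ≤ ‖F z - g z‖ₑ} := by
      intro z hz
      by_contra hcon
      simp only [mem_union, mem_ofPred_eq, not_or, not_le] at hcon
      obtain ⟨hmax, hFgz⟩ := hcon
      refine hz ?_
      have hnhds : {w | ‖g w - g z‖ₑ < ε} ∈ 𝓝 z := by
        have hc : Continuous fun w => ‖g w - g z‖ₑ := by fun_prop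
        refine hc.continuousAt.eventually_lt_const ?_
        simpa using pos_iff_ne_zero.2 hε
      filter_upwards [nhdsWithin_le_nhds (eventually_cyl_subset B κ m hnhds),
        Ioc_mem_nhdsGT (zero_lt_one' ℝ)] with r hr hr1
      have hmeas := (isOpen_cyl B κ m hr1.1.ne' z).measurableSet
      have hle : ∫⁻ w in cyl B κ m r z, ‖F w - g w‖ₑ ≤ ε * volume (cyl B κ m r z) := by
        by_contra! hlt
        exact hmax ⟨r, hr1, hlt⟩
      calc ∫⁻ w in cyl B κ m r z, ‖F w - F z‖ₑ
          ≤ ∫⁻ w in cyl B κ m r z, (‖F w - g w‖ₑ + (ε + ε)) := by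
            refine setLIntegral_mono' hmeas fun w hw => ?_
            have e : F w - F z = (F w - g w) + ((g w - g z) + (g z - F z)) := by ring
            rw [e]
            refine (enorm_add_le _ _).trans (add_le_add le_rfl ((enorm_add_le _ _).trans ?_))
            refine add_le_add (le_of_lt (hr hw)) ?_
            rw [← enorm_neg, neg_sub]
            exact hFgz.le
        _ = (∫⁻ w in cyl B κ m r z, ‖F w - g w‖ₑ) + (ε + ε) * volume (cyl B κ m r z) := by
            rw [lintegral_add_right _ measurable_const, setLIntegral_const]
        _ ≤ ε * volume (cyl B κ m r z) + (ε + ε) * volume (cyl B κ m r z) := by gcongr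
        _ = volume (cyl B κ m r z) * (3 * ε) := by ring
    have hmarkov : ε * volume {z | ε ≤ ‖F z - g z‖ₑ} ≤ ∫⁻ w, ‖F w - g w‖ₑ :=
      mul_meas_ge_le_lintegral₀ (hF.sub hgi).aestronglyMeasurable.enorm ε
    calc ε * volume bad
        ≤ ε * (volume (maximalSuperlevel B κ m (fun w => ‖F w - g w‖ₑ) ε)
            + volume {z | ε ≤ ‖F z - g z‖ₑ}) := by
          gcongr
          exact (measure_mono hsub).trans (measure_union_le _ _)
      _ ≤ C * (∫⁻ w, ‖F w - g w‖ₑ) + ∫⁻ w, ‖F w - g w‖ₑ := by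
          rw [mul_add]
          exact add_le_add (hweak _ _) hmarkov
      _ = (C + 1) * ∫⁻ w, ‖F w - g w‖ₑ := by ring
      _ ≤ (C + 1) * η := by gcongr
  have hzero : ε * volume bad = 0 := by
    have hlim : Tendsto (fun η : ℝ≥0∞ => (C + 1) * η) (𝓝[>] 0) (𝓝 0) := by
      have h := ENNReal.Tendsto.const_mul (a := C + 1) (tendsto_id (x := 𝓝 (0 : ℝ≥0∞)))
        (Or.inr (ENNReal.add_ne_top.2 ⟨hC, ENNReal.one_ne_top⟩))
      rw [mul_zero] at h
      exact h.mono_left nhdsWithin_le_nhds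
    refine le_antisymm (ge_of_tendsto hlim ?_) zero_le
    filter_upwards [self_mem_nhdsWithin] with η hη using key η (ne_of_gt hη)
  exact (mul_eq_zero.1 hzero).resolve_left hε

/-- The differentiation theorem for functions integrable on the whole space. -/
lemma ae_tendsto_lintegral_cyl
    (hB : ∀ i i' : Fin N, B i i' ≠ 0 → blkIdx κ m (i : ℕ) = blkIdx κ m (i' : ℕ) + 1)
    {F : KSpace N → ℝ} (hF : Integrable F) :
    ∀ᵐ z, Tendsto
      (fun r => (volume (cyl B κ m r z))⁻¹ * ∫⁻ w in cyl B κ m r z, ‖F w - F z‖ₑ)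
      (𝓝[>] (0 : ℝ)) (𝓝 0) := by
  have h : ∀ᵐ z, ∀ n : ℕ, ∀ᶠ r in 𝓝[>] (0 : ℝ), ∫⁻ w in cyl B κ m r z, ‖F w - F z‖ₑ
      ≤ volume (cyl B κ m r z) * (3 * ((n : ℝ≥0∞) + 1)⁻¹) :=
    ae_all_iff.2 fun n => ae_eventually_lintegral_cyl_le hB hF
      (by simp)
  filter_upwards [h] with z hz
  rw [ENNReal.tendsto_nhds_zero]
  intro δ hδ
  obtain ⟨n, hn⟩ := ENNReal.exists_inv_nat_lt (a := δ / 3)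
    (ENNReal.div_pos hδ.ne' (by simp)).ne'
  have hnδ : 3 * ((n : ℝ≥0∞) + 1)⁻¹ ≤ δ := by
    calc 3 * ((n : ℝ≥0∞) + 1)⁻¹ ≤ 3 * (δ / 3) := by
          gcongr
          exact (ENNReal.inv_le_inv.2 le_self_add).trans hn.le
      _ = δ := ENNReal.mul_div_cancel (by simp) (by simp)
  filter_upwards [hz n, self_mem_nhdsWithin] with r hr hr0
  rw [ENNReal.inv_mul_le_iff (volume_cyl_ne_zero B κ m (ne_of_gt hr0) z)
    (volume_cyl_ne_top B κ m r z)]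
  exact hr.trans (by gcongr)

end Cylinders

end

/-- **Generalized Lebesgue differentiation theorem.** For `Ω ⊂ ℝ^{N+1}` open and
`f ∈ L¹(Ω)`, for almost every `z ∈ Ω`,
`lim_{r→0⁺} |Q_r(z)|⁻¹ ∫_{Q_r(z)} |f(w) - f(z)| dw = 0`. -/
theorem generalized_lebesgue_differentiation (N κ : ℕ) (m : ℕ → ℕ) (hN : 1 ≤ N)
    (B : Matrix (Fin N) (Fin N) ℝ) (hB : IsCanonical N κ m B)
    (Ω : Set (KSpace N)) (hΩ : IsOpen Ω)
    (f : KSpace N → ℝ) (hf : MeasureTheory.IntegrableOn f Ω) :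
    ∀ᵐ z ∂(volume.restrict Ω),
      Filter.Tendsto
        (fun r : ℝ => (volume (cyl B κ m r z)).toReal⁻¹ * ∫ w in cyl B κ m r z, |f w - f z|)
        (nhdsWithin 0 (Set.Ioi 0)) (nhds 0) := by
  have hF : Integrable (Ω.indicator f) := hf.integrable_indicator hΩ.measurableSet
  rw [ae_restrict_iff' hΩ.measurableSet]
  filter_upwards [ae_tendsto_lintegral_cyl hB.2.2.2.1 hF] with z hz hzΩ
  have hreal := (ENNReal.tendsto_toReal ENNReal.zero_ne_top).comp hz
  rw [ENNReal.toReal_zero] at hreal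
  refine hreal.congr' ?_
  filter_upwards [nhdsWithin_le_nhds (eventually_cyl_subset B κ m (hΩ.mem_nhds hzΩ)),
    self_mem_nhdsWithin] with r hr hr0
  have hmeas := (isOpen_cyl B κ m (ne_of_gt hr0) z).measurableSet
  have hfm : AEStronglyMeasurable (fun w => f w - f z) (volume.restrict (cyl B κ m r z)) :=
    (hf.mono_set hr).aestronglyMeasurable.sub aestronglyMeasurable_const
  simp only [Function.comp_apply, ENNReal.toReal_mul, ENNReal.toReal_inv]
  congr 1
  simp_rw [← Real.norm_eq_abs]
  rw [integral_norm_eq_lintegral_enorm hfm]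
  congr 1
  refine setLIntegral_congr_fun hmeas fun w hw => ?_
  simp only [Set.indicator_of_mem (hr hw), Set.indicator_of_mem hzΩ]
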